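/- Let m, n ≥ 1 and let ρ be an absolutely PPT density matrix on ℂ^m ⊗ ℂ^n. Then ‖R(ρ)‖_tr ≤ 1, where R is the realignment map. That is, the realignment criterion cannot detect entanglement in any absolutely PPT state. -/

import Mathlib

open Matrix BigOperators
open scoped ComplexOrder

noncomputable section

/-- The partial transpose (on the second factor) of a matrix indexed by `Fin m × Fin n`. -/
def partialTranspose {m n : ℕ} (X : Matrix (Fin m × Fin n) (Fin m × Fin n) ℂ) :
    Matrix (Fin m × Fin n) (Fin m × Fin n) ℂ :=
  Matrix.of fun p q => X (p.1, q.2) (q.1, p.2)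

/-- A state is absolutely PPT if every unitary conjugate has positive semidefinite
partial transpose. -/
def AbsolutelyPPT {m n : ℕ} (ρ : Matrix (Fin m × Fin n) (Fin m × Fin n) ℂ) : Prop :=
  ∀ U : Matrix (Fin m × Fin n) (Fin m × Fin n) ℂ,
    U ∈ Matrix.unitaryGroup (Fin m × Fin n) ℂ →
      (partialTranspose (U * ρ * Uᴴ)).PosSemidef

/-- The trace norm of a complex matrix: the sum of its singular values,
i.e. the sum of the square roots of the eigenvalues of `Xᴴ * X`. -/
def traceNorm {d e : Type*} [Fintype d] [Fintype e] [DecidableEq e]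
    (X : Matrix d e ℂ) : ℝ :=
  ∑ i, Real.sqrt ((Matrix.posSemidef_conjTranspose_mul_self X).1.eigenvalues i)

/-- The realignment map: `R(ρ)((i,j),(k,l)) = ρ((i,k),(j,l))` for `i, j ∈ Fin m`
and `k, l ∈ Fin n`. -/
def realign {m n : ℕ} (ρ : Matrix (Fin m × Fin n) (Fin m × Fin n) ℂ) :
    Matrix (Fin m × Fin m) (Fin n × Fin n) ℂ :=
  Matrix.of fun p q => ρ (p.1, q.1) (p.2, q.2)

section SingularVectors

variable {𝕜 : Type*} [RCLike 𝕜] {d e : Type*} [Fintype d] [Fintype e]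

lemma inner_toLp_mulVec (K : Matrix d e 𝕜) (x : EuclideanSpace 𝕜 d) (y : EuclideanSpace 𝕜 e) :
    inner 𝕜 x (WithLp.toLp 2 (K *ᵥ y.ofLp)) = inner 𝕜 (WithLp.toLp 2 (Kᴴ *ᵥ x.ofLp)) y := by
  simp only [EuclideanSpace.inner_eq_star_dotProduct, star_mulVec, conjTranspose_conjTranspose]
  rw [dotProduct_comm, dotProduct_mulVec, dotProduct_comm]

variable [DecidableEq e]

/-- The squared singular values of a matrix. -/
def sqSingularValue (K : Matrix d e 𝕜) : e → ℝ :=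
  (posSemidef_conjTranspose_mul_self K).1.eigenvalues

/-- An orthonormal basis of right singular vectors of a matrix. -/
def rightSingularBasis (K : Matrix d e 𝕜) : OrthonormalBasis e 𝕜 (EuclideanSpace 𝕜 e) :=
  (posSemidef_conjTranspose_mul_self K).1.eigenvectorBasis

/-- The left singular vectors of a matrix, equal to zero at vanishing singular values. -/
def leftSingular (K : Matrix d e 𝕜) (i : e) : EuclideanSpace 𝕜 d :=
  ((√(sqSingularValue K i))⁻¹ : 𝕜) • WithLp.toLp 2 (K *ᵥ (rightSingularBasis K i).ofLp)

lemma sqSingularValue_nonneg (K : Matrix d e 𝕜) (i : e) : 0 ≤ sqSingularValue K i :=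
  (posSemidef_conjTranspose_mul_self K).eigenvalues_nonneg i

lemma inner_mulVec_rightSingularBasis (K : Matrix d e 𝕜) (i j : e) :
    inner 𝕜 (WithLp.toLp 2 (K *ᵥ (rightSingularBasis K i).ofLp))
      (WithLp.toLp 2 (K *ᵥ (rightSingularBasis K j).ofLp)) =
      if i = j then (sqSingularValue K i : 𝕜) else 0 := by
  have h := (posSemidef_conjTranspose_mul_self K).1.mulVec_eigenvectorBasis i
  rw [inner_toLp_mulVec]
  simp only [mulVec_mulVec]
  change inner 𝕜 (WithLp.toLp 2 ((Kᴴ * K) *ᵥ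
    ((posSemidef_conjTranspose_mul_self K).1.eigenvectorBasis i).ofLp)) _ = _
  rw [h]
  have h2 := orthonormal_iff_ite.mp (rightSingularBasis K).orthonormal i j
  rw [WithLp.toLp_smul, WithLp.toLp_ofLp, RCLike.real_smul_eq_coe_smul (K := 𝕜), inner_smul_left]
  change _ * inner 𝕜 (rightSingularBasis K i) (rightSingularBasis K j) = _
  rw [h2]
  simp [sqSingularValue]

lemma inner_leftSingular_mulVec (K : Matrix d e 𝕜) (i : e) :
    inner 𝕜 (leftSingular K i) (WithLp.toLp 2 (K *ᵥ (rightSingularBasis K i).ofLp)) =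
      (√(sqSingularValue K i) : 𝕜) := by
  rw [leftSingular, inner_smul_left, inner_mulVec_rightSingularBasis, if_pos rfl]
  have h := Real.mul_self_sqrt (sqSingularValue_nonneg K i)
  set s := √(sqSingularValue K i)
  rw [← h]
  by_cases h0 : s = 0
  · simp [h0]
  · have : (s : 𝕜) ≠ 0 := by exact_mod_cast h0
    push_cast
    simp only [map_inv₀, RCLike.conj_ofReal]
    field_simp

lemma orthonormal_leftSingular (K : Matrix d e 𝕜) :
    Orthonormal 𝕜 (({i | sqSingularValue K i ≠ 0} : Set e).domRestrict (leftSingular K)) := by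
  rw [orthonormal_iff_ite]
  rintro ⟨i, hi⟩ ⟨j, hj⟩
  simp only [Set.domRestrict_apply, leftSingular, inner_smul_left, inner_smul_right,
    inner_mulVec_rightSingularBasis, Subtype.mk.injEq]
  split_ifs with hij
  · subst hij
    have h := Real.mul_self_sqrt (sqSingularValue_nonneg K i)
    have h0 : √(sqSingularValue K i) ≠ 0 := fun h0 => hi (by rw [← h, h0, zero_mul])
    set s := √(sqSingularValue K i)
    have : (s : 𝕜) ≠ 0 := by exact_mod_cast h0
    rw [← h]
    push_cast
    simp only [map_inv₀, RCLike.conj_ofReal]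
    field_simp
  · simp

lemma leftSingular_eq_zero {K : Matrix d e 𝕜} {i : e} (h : sqSingularValue K i = 0) :
    leftSingular K i = 0 := by
  simp [leftSingular, h]

lemma sum_sq_norm_leftSingular_le (K : Matrix d e 𝕜) :
    ∑ i, ‖leftSingular K i‖ ^ 2 ≤ K.rank := by
  classical
  have hr : K.rank = Fintype.card {i // sqSingularValue K i ≠ 0} := by
    rw [← rank_conjTranspose_mul_self]
    exact (posSemidef_conjTranspose_mul_self K).1.rank_eq_card_non_zero_eigs
  rw [hr, Fintype.card_subtype, Finset.card_filter, Nat.cast_sum]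
  refine Finset.sum_le_sum fun i _ => ?_
  split_ifs with h
  · have := (orthonormal_leftSingular K).1 ⟨i, h⟩
    simp only [Set.domRestrict_apply] at this
    simp [this]
  · rw [leftSingular_eq_zero (not_not.mp h)]
    simp

lemma sum_sq_norm_inner_leftSingular_le (K : Matrix d e 𝕜) (u : EuclideanSpace 𝕜 d) :
    ∑ i, ‖inner 𝕜 (leftSingular K i) u‖ ^ 2 ≤ ‖u‖ ^ 2 := by
  classical
  have h := (orthonormal_leftSingular K).sum_inner_products_le u (s := Finset.univ)
  refine le_trans (le_of_eq ?_) h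
  simp only [Set.domRestrict_apply]
  rw [Finset.sum_set_coe (f := fun i => ‖inner 𝕜 (leftSingular K i) u‖ ^ 2)]
  symm
  refine Finset.sum_subset (Finset.subset_univ _) fun i _ hi => ?_
  have : sqSingularValue K i = 0 := by simpa using hi
  simp [leftSingular_eq_zero this]

lemma sum_sq_norm_mulVec_rightSingularBasis (K : Matrix d e 𝕜) :
    ∑ i, ‖(WithLp.toLp 2 (K *ᵥ (rightSingularBasis K i).ofLp) : EuclideanSpace 𝕜 d)‖ ^ 2 =
      RCLike.re (Kᴴ * K).trace := by
  rw [(posSemidef_conjTranspose_mul_self K).1.trace_eq_sum_eigenvalues, map_sum]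
  refine Finset.sum_congr rfl fun i _ => ?_
  rw [← inner_self_eq_norm_sq (𝕜 := 𝕜), inner_mulVec_rightSingularBasis, if_pos rfl]
  rfl

end SingularVectors

lemma norm_sub_re_inner_smul_sq {𝕜 E : Type*} [RCLike 𝕜] [NormedAddCommGroup E]
    [InnerProductSpace 𝕜 E] (x z : E) (hz : ‖z‖ = 1) :
    ‖x - ((RCLike.re (inner 𝕜 x z) : ℝ) : 𝕜) • z‖ ^ 2 =
      ‖x‖ ^ 2 - RCLike.re (inner 𝕜 x z) ^ 2 := by
  rw [norm_sub_sq (𝕜 := 𝕜), inner_smul_right, norm_smul, RCLike.re_ofReal_mul, hz]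
  simp only [RCLike.norm_ofReal, mul_one, sq_abs]
  ring

lemma re_inner_le_of_unit {𝕜 E : Type*} [RCLike 𝕜] [NormedAddCommGroup E]
    [InnerProductSpace 𝕜 E] (x y z : E) (hz : ‖z‖ = 1) :
    RCLike.re (inner 𝕜 x y) ≤
      √(‖x‖ ^ 2 - RCLike.re (inner 𝕜 x z) ^ 2) * √(‖y‖ ^ 2 - RCLike.re (inner 𝕜 z y) ^ 2) +
        RCLike.re (inner 𝕜 x z) * RCLike.re (inner 𝕜 z y) := by
  have hx := norm_sub_re_inner_smul_sq (𝕜 := 𝕜) x z hz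
  have hy := norm_sub_re_inner_smul_sq (𝕜 := 𝕜) y z hz
  rw [inner_re_symm y z] at hy
  set w := RCLike.re (inner 𝕜 x z) with hw
  set a := RCLike.re (inner 𝕜 z y) with ha
  have h := re_inner_le_norm (𝕜 := 𝕜) (x - (w : 𝕜) • z) (y - (a : 𝕜) • z)
  rw [← hx, ← hy, Real.sqrt_sq (norm_nonneg _), Real.sqrt_sq (norm_nonneg _)]
  have he : RCLike.re (inner 𝕜 (x - (w : 𝕜) • z) (y - (a : 𝕜) • z)) =
      RCLike.re (inner 𝕜 x y) - w * a := by
    simp only [inner_sub_left, inner_sub_right, inner_smul_left, inner_smul_right, map_sub,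
      RCLike.re_ofReal_mul, RCLike.conj_ofReal, inner_self_eq_norm_sq, hz, ← hw, ← ha]
    ring
  linarith

/-- A bound for the sum of the singular values of a matrix in terms of its rank, its Frobenius
norm and its matrix coefficient at a pair of unit vectors. -/
lemma exists_sum_sqrt_sqSingularValue_le {𝕜 d e : Type*} [RCLike 𝕜] [Fintype d] [Fintype e]
    [DecidableEq e] (K : Matrix d e 𝕜) (u : EuclideanSpace 𝕜 d) (v : EuclideanSpace 𝕜 e)
    (hu : ‖u‖ = 1) (hv : ‖v‖ = 1) (a : ℝ)
    (ha : inner 𝕜 u (WithLp.toLp 2 (K *ᵥ v.ofLp)) = (a : 𝕜)) :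
    ∃ w : ℝ, w ≤ 1 ∧ w ^ 2 ≤ K.rank ∧ a ^ 2 ≤ RCLike.re (Kᴴ * K).trace ∧
      ∑ i, √(sqSingularValue K i) ≤
        √(K.rank - w ^ 2) * √(RCLike.re (Kᴴ * K).trace - a ^ 2) + w * a := by
  let b := rightSingularBasis K
  let x : PiLp 2 fun _ : e => EuclideanSpace 𝕜 d := WithLp.toLp 2 (leftSingular K)
  let y : PiLp 2 fun _ : e => EuclideanSpace 𝕜 d :=
    WithLp.toLp 2 fun i => WithLp.toLp 2 (K *ᵥ (b i).ofLp)
  let z : PiLp 2 fun _ : e => EuclideanSpace 𝕜 d := WithLp.toLp 2 fun i => inner 𝕜 v (b i) • u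
  have hz : ‖z‖ = 1 := by
    have h : ‖z‖ ^ 2 = 1 := by
      rw [PiLp.norm_sq_eq_of_L2]
      simp only [z, norm_smul, hu, mul_one, norm_inner_symm v]
      rw [b.sum_sq_norm_inner_right v, hv, one_pow]
    nlinarith [norm_nonneg z]
  have hx : ‖x‖ ^ 2 ≤ K.rank := by
    rw [PiLp.norm_sq_eq_of_L2]
    exact sum_sq_norm_leftSingular_le K
  have hy : ‖y‖ ^ 2 = RCLike.re (Kᴴ * K).trace := by
    rw [PiLp.norm_sq_eq_of_L2]
    exact sum_sq_norm_mulVec_rightSingularBasis K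
  have hxy : inner 𝕜 x y = ((∑ i, √(sqSingularValue K i) : ℝ) : 𝕜) := by
    rw [PiLp.inner_apply]
    push_cast
    exact Finset.sum_congr rfl fun i _ => inner_leftSingular_mulVec K i
  have hzy : inner 𝕜 z y = (a : 𝕜) := by
    rw [PiLp.inner_apply, ← ha, inner_toLp_mulVec, ← b.sum_inner_mul_inner]
    simp only [z, y, inner_smul_left, inner_toLp_mulVec, inner_conj_symm]
    exact Finset.sum_congr rfl fun i _ => mul_comm _ _
  have hw : RCLike.re (inner 𝕜 x z) ≤ 1 := by
    have h1 : ‖inner 𝕜 x z‖ ≤ ∑ i, ‖inner 𝕜 v (b i)‖ * ‖inner 𝕜 (leftSingular K i) u‖ := by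
      rw [PiLp.inner_apply]
      refine (norm_sum_le _ _).trans (Finset.sum_le_sum fun i _ => ?_)
      simp only [x, z, inner_smul_right, norm_mul, le_refl]
    have h2 := Finset.sum_mul_sq_le_sq_mul_sq Finset.univ (fun i => ‖inner 𝕜 v (b i)‖)
      (fun i => ‖inner 𝕜 (leftSingular K i) u‖)
    have h3 := sum_sq_norm_inner_leftSingular_le K u
    simp only [norm_inner_symm v] at h1 h2
    rw [b.sum_sq_norm_inner_right v, hv, one_pow, one_mul] at h2
    rw [hu, one_pow] at h3
    have h4 := abs_le_of_sq_le_sq (h2.trans h3 |>.trans_eq (one_pow 2).symm) zero_le_one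
    exact ((RCLike.re_le_norm _).trans h1).trans ((le_abs_self _).trans h4)
  have hwx := norm_sub_re_inner_smul_sq (𝕜 := 𝕜) x z hz
  have hay := norm_sub_re_inner_smul_sq (𝕜 := 𝕜) y z hz
  rw [inner_re_symm y z, hzy, RCLike.ofReal_re, hy] at hay
  refine ⟨RCLike.re (inner 𝕜 x z), hw, ?_, ?_, ?_⟩
  · nlinarith [sq_nonneg ‖x - ((RCLike.re (inner 𝕜 x z) : ℝ) : 𝕜) • z‖]
  · exact sub_nonneg.mp (hay ▸ sq_nonneg _)
  · have h := re_inner_le_of_unit (𝕜 := 𝕜) x y z hz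
    rw [hxy, hzy, RCLike.ofReal_re, RCLike.ofReal_re, hy] at h
    refine h.trans ?_
    gcongr

/-- Up to two exceptional indices, the eigenvalues of an absolutely PPT state lie within a
factor `3` of the largest one, which bounds the purity. -/
lemma sum_sq_le_of_sq_sub_le {ι : Type*} [Fintype ι] [DecidableEq ι] (hι : 4 ≤ Fintype.card ι)
    (r : ι → ℝ) (hr : ∀ i, 0 ≤ r i) (hsum : ∑ i, r i = 1)
    (h : ∀ i j k l, i ≠ j → i ≠ k → i ≠ l → j ≠ k → j ≠ l → k ≠ l →
      (r i - r j) ^ 2 ≤ 4 * (r k * r l)) :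
    3 * ((Fintype.card ι : ℝ) - 1) * ∑ i, r i ^ 2 ≤ 4 := by
  have : Nonempty ι := Fintype.card_pos_iff.mp (by omega)
  obtain ⟨i₀, -, hi₀⟩ := Finset.exists_max_image Finset.univ r Finset.univ_nonempty
  set L := r i₀ with hL
  have hmax : ∀ i, r i ≤ L := fun i => hi₀ i (Finset.mem_univ _)
  have hLpos : 0 < L := by
    by_contra! hle
    have : ∑ i, r i ≤ 0 := Finset.sum_nonpos fun i _ => (hmax i).trans hle
    linarith
  set s := Finset.univ.filter fun i => r i < L / 3 with hs
  have hmem : ∀ i, i ∈ s ↔ r i < L / 3 := fun i => by simp [hs]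
  have hne : ∀ i ∈ s, i₀ ≠ i := by
    rintro i hi rfl
    have := (hmem _).mp hi
    linarith
  have hcard : s.card ≤ 2 := by
    by_contra! hc
    obtain ⟨i, j, k, hi, hj, hk, hij, hik, hjk⟩ := Finset.two_lt_card_iff.mp hc
    have h1 := h i₀ i j k (hne i hi) (hne j hj) (hne k hk) hij hik hjk
    have h2 := (hmem _).mp hi
    have h3 := (hmem _).mp hj
    have h4 := (hmem _).mp hk
    nlinarith [hr i, hr j, hr k]
  have hsmall : -(L ^ 2 / 3) ≤ ∑ i ∈ s, (r i - L / 3) * (L - r i) := by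
    obtain h0 | h1 | h2 : s.card = 0 ∨ s.card = 1 ∨ s.card = 2 := by omega
    · rw [Finset.card_eq_zero.mp h0, Finset.sum_empty]
      nlinarith
    · obtain ⟨i, hi⟩ := Finset.card_eq_one.mp h1
      have := (hmem i).mp (by simp [hi])
      rw [hi, Finset.sum_singleton]
      nlinarith [hr i]
    · obtain ⟨i, j, hij, hsij⟩ := Finset.card_eq_two.mp h2
      have hi : i ∈ s := by simp [hsij]
      have hj : j ∈ s := by simp [hsij]
      obtain ⟨k, hk⟩ : ∃ k, k ∉ ({i₀, i, j} : Finset ι) := by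
        by_contra! hall
        have := Finset.card_le_card (fun x _ => hall x : Finset.univ ⊆ ({i₀, i, j} : Finset ι))
        have := Finset.card_le_three (a := i₀) (b := i) (c := j)
        rw [Finset.card_univ] at *
        omega
      simp only [Finset.mem_insert, Finset.mem_singleton, not_or] at hk
      obtain ⟨hk0, hki, hkj⟩ := hk
      have e1 := h i₀ i k j (hne i hi) (Ne.symm hk0) (hne j hj) (Ne.symm hki) hij hkj
      have e2 := h i₀ j k i (hne j hj) (Ne.symm hk0) (hne i hi) (Ne.symm hkj) hij.symm hki
      have f1 := (hmem _).mp hi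
      have f2 := (hmem _).mp hj
      have g1 : (L - r i) ^ 2 ≤ 4 * (L * r j) := by nlinarith [hr j, hmax k]
      have g2 : (L - r j) ^ 2 ≤ 4 * (L * r i) := by nlinarith [hr i, hmax k]
      have g3 : L / 3 ≤ r i + r j := by
        by_contra! hlt
        nlinarith [sq_nonneg (r i), sq_nonneg (r j)]
      rw [hsij, Finset.sum_pair hij]
      nlinarith [hr i, hr j, mul_nonneg (hr i) (sub_nonneg.mpr f1.le),
        mul_nonneg (hr j) (sub_nonneg.mpr f2.le)]
  have hall : ∑ i ∈ s, (r i - L / 3) * (L - r i) ≤ ∑ i, (r i - L / 3) * (L - r i) := by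
    refine Finset.sum_le_sum_of_subset_of_nonneg (Finset.subset_univ _) fun i _ hi => ?_
    have := not_lt.mp (fun hlt => hi ((hmem i).mpr hlt))
    exact mul_nonneg (by linarith) (sub_nonneg.mpr (hmax i))
  have hexp : ∑ i, (r i - L / 3) * (L - r i) =
      4 * L / 3 - ∑ i, r i ^ 2 - Fintype.card ι * (L ^ 2 / 3) := by
    have : ∀ i, (r i - L / 3) * (L - r i) = 4 * L / 3 * r i - r i ^ 2 - L ^ 2 / 3 :=
      fun i => by ring
    simp only [this, Finset.sum_sub_distrib, ← Finset.mul_sum, hsum, Finset.sum_const,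
      Finset.card_univ, nsmul_eq_mul, mul_one]
  have hN : (4 : ℝ) ≤ Fintype.card ι := by exact_mod_cast hι
  set N := (Fintype.card ι : ℝ)
  have hp : ∑ i, r i ^ 2 ≤ 4 * L / 3 - (N - 1) * (L ^ 2 / 3) := by linarith
  nlinarith [sq_nonneg ((N - 1) * L - 2)]

lemma sqrt_mul_sqrt_add_le_one {N p w k a : ℝ} (hk : k = 2 ∧ 6 ≤ N ∨ 3 ≤ k ∧ k ^ 2 ≤ N)
    (hp : 3 * (N - 1) * p ≤ 4) (ha : 0 ≤ a) (ha2 : a ^ 2 * N = 1)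
    (hw : w ≤ 1) (hwk : w ^ 2 ≤ k ^ 2) :
    √(k ^ 2 - w ^ 2) * √(p - a ^ 2) + w * a ≤ 1 := by
  have hN : 6 ≤ N := by rcases hk with ⟨-, h⟩ | ⟨h1, h2⟩ <;> nlinarith
  obtain ⟨M, hM, hMN⟩ : ∃ M : ℝ, 0 ≤ M ∧ M ^ 2 = N := ⟨√N, by positivity, Real.sq_sqrt (by linarith)⟩
  have haM : a * M = 1 := by
    have : (a * M) ^ 2 = 1 := by rw [mul_pow, hMN, ha2]
    nlinarith [mul_nonneg ha hM]
  have hM2 : 2.449 ≤ M := by nlinarith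
  have hwM : w * a ≤ 1 := by nlinarith
  have key : (k ^ 2 - w ^ 2) * (N + 3) ≤ 3 * (N - 1) * (M - w) ^ 2 := by
    rcases hk with ⟨rfl, h6⟩ | ⟨h3, hkN⟩
    · have h1 : 3 * (2 ^ 2 - w ^ 2) ≤ 5 * (M - w) ^ 2 := by nlinarith
      have h2 : 5 * (N + 3) ≤ 9 * (N - 1) := by linarith
      nlinarith [sq_nonneg (M - w)]
    · have hM3 : 3 ≤ M := by nlinarith
      have h1 : (M + w) * (N + 3) ≤ 3 * (N - 1) * (M - w) := by
        have : w * (4 * N) ≤ 4 * N := by nlinarith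
        have : 4 * N ≤ M * (2 * N - 6) := by
          rw [← hMN]; nlinarith
        nlinarith
      have h2 : k ^ 2 - w ^ 2 ≤ (M - w) * (M + w) := by nlinarith
      have h3 : (M - w) * ((M + w) * (N + 3)) ≤ (M - w) * (3 * (N - 1) * (M - w)) :=
        mul_le_mul_of_nonneg_left h1 (by linarith)
      nlinarith
  have hprod : (k ^ 2 - w ^ 2) * (p - a ^ 2) ≤ (1 - w * a) ^ 2 := by
    have e1 : 3 * (N - 1) * N * (p - a ^ 2) ≤ N + 3 := by nlinarith
    have e2 : (1 - w * a) ^ 2 * N = (M - w) ^ 2 := by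
      rw [← hMN, ← mul_pow]
      congr 1
      linear_combination -w * haM
    have e3 : (k ^ 2 - w ^ 2) * (3 * (N - 1) * N * (p - a ^ 2)) ≤
        (k ^ 2 - w ^ 2) * (N + 3) := mul_le_mul_of_nonneg_left e1 (by linarith)
    have e4 : 3 * (N - 1) * N * ((k ^ 2 - w ^ 2) * (p - a ^ 2)) ≤
        3 * (N - 1) * N * (1 - w * a) ^ 2 := by
      calc _ ≤ 3 * (N - 1) * (M - w) ^ 2 := by linarith
        _ = _ := by rw [← e2]; ring
    exact le_of_mul_le_mul_left e4 (by nlinarith)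
  rw [← Real.sqrt_mul (by linarith)]
  have := Real.sqrt_le_sqrt hprod
  rw [Real.sqrt_sq (by linarith)] at this
  linarith

lemma Matrix.PosSemidef.norm_sq_apply_le {ι : Type*} {M : Matrix ι ι ℂ} (hM : M.PosSemidef)
    (p q : ι) : ‖M p q‖ ^ 2 ≤ (M p p).re * (M q q).re := by
  have h := (hM.submatrix ![p, q]).det_nonneg
  rw [det_fin_two] at h
  simp only [submatrix_apply, cons_val_zero, cons_val_one] at h
  have h1 : M q p = star (M p q) := (hM.1.apply q p).symm
  have hp : (M p p).im = 0 := Complex.conj_eq_iff_im.mp (hM.1.apply p p)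
  have hq : (M q q).im = 0 := Complex.conj_eq_iff_im.mp (hM.1.apply q q)
  rw [h1, Complex.star_def, Complex.mul_conj, ← Complex.sq_norm] at h
  have h2 := (Complex.le_def.mp h).1
  rw [Complex.sub_re, Complex.mul_re, hp, hq, Complex.ofReal_re, Complex.zero_re] at h2
  linarith

section AbsolutelyPPT

variable {m n : ℕ} {ρ : Matrix (Fin m × Fin n) (Fin m × Fin n) ℂ}

lemma AbsolutelyPPT.conj (h : AbsolutelyPPT ρ) {V : Matrix (Fin m × Fin n) (Fin m × Fin n) ℂ}
    (hV : V ∈ unitaryGroup (Fin m × Fin n) ℂ) : AbsolutelyPPT (V * ρ * Vᴴ) := by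
  intro U hU
  have := h (U * V) (mul_mem hU hV)
  rwa [conjTranspose_mul, ← Matrix.mul_assoc, Matrix.mul_assoc U V, Matrix.mul_assoc U] at this

lemma AbsolutelyPPT.posSemidef_partialTranspose (h : AbsolutelyPPT ρ) :
    (partialTranspose ρ).PosSemidef := by
  simpa using h 1 (one_mem _)

lemma AbsolutelyPPT.norm_sq_apply_le (h : AbsolutelyPPT ρ) (i j : Fin m) (k l : Fin n) :
    ‖ρ (i, k) (j, l)‖ ^ 2 ≤ (ρ (i, l) (i, l)).re * (ρ (j, k) (j, k)).re :=
  h.posSemidef_partialTranspose.norm_sq_apply_le (i, l) (j, k)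

end AbsolutelyPPT

section MixingUnitary

variable {ι : Type*} [DecidableEq ι]

/-- The orthogonal projection onto the span of the sum of two basis vectors. -/
def pairProj (a b : ι) : Matrix ι ι ℂ :=
  (1 / 2 : ℂ) • vecMulVec (Pi.single a 1 + Pi.single b 1) (Pi.single a 1 + Pi.single b 1)

lemma pairProj_apply (a b p q : ι) :
    pairProj a b p q = 1 / 2 * ((if p = a then 1 else 0) + if p = b then 1 else 0) *
      ((if q = a then 1 else 0) + if q = b then 1 else 0) := by
  simp [pairProj, vecMulVec_apply, Pi.single_apply, mul_assoc]

lemma pairProj_conjTranspose (a b : ι) : (pairProj a b)ᴴ = pairProj a b := by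
  ext p q
  rw [conjTranspose_apply, pairProj_apply, pairProj_apply]
  split_ifs <;> simp

/-- A unitary mixing two basis vectors and fixing the others. -/
def pairMix (a b : ι) : Matrix ι ι ℂ := 1 + (Complex.I - 1) • pairProj a b

lemma pairMix_conjTranspose (a b : ι) :
    (pairMix a b)ᴴ = 1 + (-Complex.I - 1) • pairProj a b := by
  simp [pairMix, pairProj_conjTranspose]

lemma pairMix_apply_of_ne {a b p : ι} (ha : p ≠ a) (hb : p ≠ b) (x : ι) :
    pairMix a b p x = (1 : Matrix ι ι ℂ) p x := by
  simp [pairMix, pairProj_apply, ha, hb]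

variable [Fintype ι]

lemma pairProj_mul_self {a b : ι} (hab : a ≠ b) : pairProj a b * pairProj a b = pairProj a b := by
  rw [pairProj, smul_mul_smul_comm, vecMulVec_mul_vecMulVec]
  have : (Pi.single a 1 + Pi.single b 1 : ι → ℂ) ⬝ᵥ (Pi.single a 1 + Pi.single b 1) = 2 := by
    simp [hab, hab.symm]; norm_num
  rw [this, vecMulVec_smul, smul_smul]
  norm_num

lemma pairMix_mem_unitaryGroup {a b : ι} (hab : a ≠ b) :
    pairMix a b ∈ unitaryGroup ι ℂ := by
  rw [mem_unitaryGroup_iff, star_eq_conjTranspose, pairMix_conjTranspose, pairMix]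
  have hP := pairProj_mul_self hab
  have hI := Complex.I_mul_I
  simp only [add_mul, mul_add, one_mul, mul_one, smul_mul_smul_comm, hP]
  rw [add_assoc, add_eq_left, ← add_smul, ← add_smul]
  have : -Complex.I - 1 + (Complex.I - 1 + (Complex.I - 1) * (-Complex.I - 1)) = 0 := by
    linear_combination -hI
  simp only [← add_assoc] at this ⊢
  convert zero_smul ℂ (pairProj a b) using 2
  linear_combination this

lemma pairMix_mul_diagonal_apply (a b : ι) (D : ι → ℂ) (p q : ι) :
    (pairMix a b * diagonal D * (pairMix a b)ᴴ) p q =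
      ∑ x, pairMix a b p x * D x * star (pairMix a b q x) := by
  simp [mul_apply, diagonal_apply]

lemma pairMix_conj_diagonal_apply_self {a b p : ι} (ha : p ≠ a) (hb : p ≠ b) (D : ι → ℂ) :
    (pairMix a b * diagonal D * (pairMix a b)ᴴ) p p = D p := by
  simp [pairMix_mul_diagonal_apply, pairMix_apply_of_ne ha hb, one_apply]

lemma pairMix_conj_diagonal_apply {a b : ι} (hab : a ≠ b) (D : ι → ℂ) :
    (pairMix a b * diagonal D * (pairMix a b)ᴴ) a b = -(Complex.I / 2) * (D a - D b) := by
  rw [pairMix_mul_diagonal_apply, ← Finset.sum_subset (Finset.subset_univ {a, b}),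
    Finset.sum_pair hab]
  · simp [pairMix, pairProj_apply, hab, hab.symm, one_apply]
    ring_nf
    simp only [Complex.I_sq]
    ring
  · intro x _ hx
    simp only [Finset.mem_insert, Finset.mem_singleton, not_or] at hx
    simp [pairMix, pairProj_apply, hx.1, hx.2, one_apply, Ne.symm hx.1]

end MixingUnitary

lemma AbsolutelyPPT.diagonal_sq_sub_le {m n : ℕ} (hm : 2 ≤ m) (hn : 2 ≤ n)
    (r : Fin m × Fin n → ℝ) (h : AbsolutelyPPT (diagonal fun p => (r p : ℂ))) :
    (r (⟨0, by omega⟩, ⟨1, by omega⟩) - r (⟨1, by omega⟩, ⟨0, by omega⟩)) ^ 2 ≤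
      4 * (r (⟨0, by omega⟩, ⟨0, by omega⟩) * r (⟨1, by omega⟩, ⟨1, by omega⟩)) := by
  set p₀ : Fin m := ⟨0, by omega⟩
  set p₁ : Fin m := ⟨1, by omega⟩
  set q₀ : Fin n := ⟨0, by omega⟩
  set q₁ : Fin n := ⟨1, by omega⟩
  have hp : p₀ ≠ p₁ := by simp [p₀, p₁]
  have hq : q₀ ≠ q₁ := by simp [q₀, q₁]
  have hab : (p₀, q₁) ≠ (p₁, q₀) := by simp [hp]
  have h1 := (h.conj (pairMix_mem_unitaryGroup hab)).norm_sq_apply_le p₀ p₁ q₁ q₀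
  rw [pairMix_conj_diagonal_apply hab, pairMix_conj_diagonal_apply_self (by simp [hq])
    (by simp [hp]), pairMix_conj_diagonal_apply_self (by simp [hp.symm]) (by simp [hq.symm]),
    ← Complex.ofReal_sub, norm_mul, mul_pow] at h1
  simp only [norm_neg, norm_div, Complex.norm_I, Complex.norm_ofNat, Complex.norm_real,
    Real.norm_eq_abs, sq_abs, Complex.ofReal_re] at h1
  linarith

lemma exists_perm_apply_eq {ι : Type*} [Finite ι] {a b c d i j k l : ι} (h : [a, b, c, d].Nodup)
    (h' : [i, j, k, l].Nodup) : ∃ σ : Equiv.Perm ι, σ a = i ∧ σ b = j ∧ σ c = k ∧ σ d = l := by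
  have hf : Function.Injective ![a, b, c, d] := by
    have := List.nodup_iff_injective_get.mp h
    intro x y hxy
    fin_cases x <;> fin_cases y <;> simp_all
  have hg : Function.Injective ![i, j, k, l] := by
    intro x y hxy
    fin_cases x <;> fin_cases y <;> simp_all
  obtain ⟨σ, hσ⟩ := Equiv.Perm.exists_extending_pair _ _ hf hg
  exact ⟨σ, hσ 0, hσ 1, hσ 2, hσ 3⟩

lemma AbsolutelyPPT.eigenvalues_sq_sub_le {m n : ℕ} (hm : 2 ≤ m) (hn : 2 ≤ n)
    {ρ : Matrix (Fin m × Fin n) (Fin m × Fin n) ℂ} (hρ : ρ.IsHermitian) (h : AbsolutelyPPT ρ)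
    (i j k l : Fin m × Fin n) (hij : i ≠ j) (hik : i ≠ k) (hil : i ≠ l) (hjk : j ≠ k)
    (hjl : j ≠ l) (hkl : k ≠ l) :
    (hρ.eigenvalues i - hρ.eigenvalues j) ^ 2 ≤ 4 * (hρ.eigenvalues k * hρ.eigenvalues l) := by
  obtain ⟨σ, h1, h2, h3, h4⟩ := exists_perm_apply_eq
    (a := ((⟨0, by omega⟩, ⟨1, by omega⟩) : Fin m × Fin n)) (b := (⟨1, by omega⟩, ⟨0, by omega⟩))
    (c := (⟨0, by omega⟩, ⟨0, by omega⟩)) (d := (⟨1, by omega⟩, ⟨1, by omega⟩)) (i := i) (j := j)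
    (k := k) (l := l) (by simp) (by simp [*])
  have key : AbsolutelyPPT (diagonal fun p => (hρ.eigenvalues (σ p) : ℂ)) := by
    set V : Matrix (Fin m × Fin n) (Fin m × Fin n) ℂ := hρ.eigenvectorUnitary.1
    have hVV : Vᴴ * V = 1 := mem_unitaryGroup_iff'.mp hρ.eigenvectorUnitary.2
    have hD : Vᴴ * ρ * V = diagonal (RCLike.ofReal ∘ hρ.eigenvalues) := by
      simpa [Unitary.conjStarAlgAut_apply, star_eq_conjTranspose] using
        hρ.conjStarAlgAut_star_eigenvectorUnitary
    have hV : Vᴴ.submatrix σ id ∈ unitaryGroup (Fin m × Fin n) ℂ := by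
      rw [mem_unitaryGroup_iff, star_eq_conjTranspose, conjTranspose_submatrix,
        conjTranspose_conjTranspose, ← submatrix_mul _ _ _ id _ Function.bijective_id, hVV,
        submatrix_one_equiv]
    convert h.conj hV using 1
    rw [conjTranspose_submatrix, conjTranspose_conjTranspose]
    have : Vᴴ.submatrix σ id * ρ * V.submatrix id σ = (Vᴴ * ρ * V).submatrix σ σ := by
      ext p q
      simp [mul_apply]
    rw [this, hD, submatrix_diagonal_equiv]
    rfl
  have := key.diagonal_sq_sub_le hm hn
  rwa [h1, h2, h3, h4] at this

lemma trace_conjTranspose_realign_mul_realign {m n : ℕ}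
    (W : Matrix (Fin m × Fin m) (Fin n × Fin n) ℂ)
    (ρ X : Matrix (Fin m × Fin n) (Fin m × Fin n) ℂ) (hX : realign X = W) :
    (Wᴴ * realign ρ).trace = (Xᴴ * ρ).trace := by
  subst hX
  let σ : (Fin n × Fin n) × (Fin m × Fin m) ≃ (Fin m × Fin n) × (Fin m × Fin n) :=
    { toFun := fun x => ((x.2.2, x.1.2), (x.2.1, x.1.1))
      invFun := fun y => ((y.2.2, y.1.2), (y.2.1, y.1.1))
      left_inv := fun _ => rfl
      right_inv := fun _ => rfl }
  simp only [trace, diag_apply, mul_apply, conjTranspose_apply, realign, of_apply,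
    ← Fintype.sum_prod_type']
  exact Fintype.sum_equiv σ _ _ fun _ => rfl

lemma Matrix.IsHermitian.trace_mul_self_eq_sum_sq {ι : Type*} [Fintype ι] [DecidableEq ι]
    {A : Matrix ι ι ℂ} (hA : A.IsHermitian) :
    (A * A).trace = ((∑ i, hA.eigenvalues i ^ 2 : ℝ) : ℂ) := by
  set V : Matrix ι ι ℂ := hA.eigenvectorUnitary.1
  have hVV : V * Vᴴ = 1 := mem_unitaryGroup_iff.mp hA.eigenvectorUnitary.2
  have hD : Vᴴ * A * V = diagonal (RCLike.ofReal ∘ hA.eigenvalues) := by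
    simpa [Unitary.conjStarAlgAut_apply, star_eq_conjTranspose] using
      hA.conjStarAlgAut_star_eigenvectorUnitary
  have h : (Vᴴ * A * V * (Vᴴ * A * V)).trace = (A * A).trace := by
    calc _ = (Vᴴ * (A * (V * Vᴴ) * A * V)).trace := by simp only [Matrix.mul_assoc]
      _ = (A * A * (V * Vᴴ)).trace := by
        rw [trace_mul_comm, hVV]; simp only [Matrix.mul_assoc, Matrix.mul_one, hVV]
      _ = _ := by rw [hVV, Matrix.mul_one]
  rw [← h, hD, diagonal_mul_diagonal, trace_diagonal]
  simp [pow_two]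

/-- The normalized vectorization of the identity matrix. -/
def maxEntangled (m : ℕ) : EuclideanSpace ℂ (Fin m × Fin m) :=
  ((√(m : ℝ))⁻¹ : ℂ) • WithLp.toLp 2 fun p => if p.1 = p.2 then 1 else 0

lemma norm_maxEntangled {m : ℕ} (hm : 1 ≤ m) : ‖maxEntangled m‖ = 1 := by
  have h : ‖(WithLp.toLp 2 fun p => if p.1 = p.2 then 1 else 0 :
      EuclideanSpace ℂ (Fin m × Fin m))‖ = √m := by
    rw [EuclideanSpace.norm_eq]
    simp only [Fintype.sum_prod_type, apply_ite norm, norm_one, norm_zero]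
    simp
  have hm' : (0 : ℝ) < √m := Real.sqrt_pos.mpr (by exact_mod_cast hm)
  rw [maxEntangled, norm_smul, h, norm_inv, Complex.norm_real, Real.norm_of_nonneg hm'.le,
    inv_mul_cancel₀ hm'.ne']

lemma inner_maxEntangled_realign {m n : ℕ} (ρ : Matrix (Fin m × Fin n) (Fin m × Fin n) ℂ) :
    inner ℂ (maxEntangled m) (WithLp.toLp 2 (realign ρ *ᵥ (maxEntangled n).ofLp)) =
      ((√(m : ℝ))⁻¹ * (√(n : ℝ))⁻¹ : ℝ) * ρ.trace := by
  simp only [maxEntangled, WithLp.ofLp_smul, mulVec_smul, WithLp.toLp_smul, inner_smul_left,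
    inner_smul_right, EuclideanSpace.inner_eq_star_dotProduct]
  have : (realign ρ *ᵥ fun p => if p.1 = p.2 then 1 else 0) ⬝ᵥ
      star (fun p : Fin m × Fin m => if p.1 = p.2 then (1 : ℂ) else 0) = ρ.trace := by
    simp [dotProduct, mulVec, realign, trace, Fintype.sum_prod_type, apply_ite]
  rw [this]
  simp [mul_left_comm, mul_assoc]

lemma traceNorm_realign_le_of_min {m n : ℕ} (ρ : Matrix (Fin m × Fin n) (Fin m × Fin n) ℂ)
    (hm : 1 ≤ m) (hn : 1 ≤ n) (hρ : ρ.IsHermitian) (htr : ρ.trace = 1) :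
    ∃ a w : ℝ, 0 ≤ a ∧ a ^ 2 * (m * n) = 1 ∧ w ≤ 1 ∧ w ^ 2 ≤ (min m n : ℝ) ^ 2 ∧
      a ^ 2 ≤ ∑ i, hρ.eigenvalues i ^ 2 ∧
      traceNorm (realign ρ) ≤
        √((min m n : ℝ) ^ 2 - w ^ 2) * √(∑ i, hρ.eigenvalues i ^ 2 - a ^ 2) + w * a := by
  have hp : RCLike.re ((realign ρ)ᴴ * realign ρ).trace = ∑ i, hρ.eigenvalues i ^ 2 := by
    rw [trace_conjTranspose_realign_mul_realign _ ρ ρ rfl, hρ, hρ.trace_mul_self_eq_sum_sq]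
    rfl
  have hrank : ((realign ρ).rank : ℝ) ≤ (min m n : ℝ) ^ 2 := by
    have h1 := (realign ρ).rank_le_card_height
    have h2 := (realign ρ).rank_le_card_width
    rw [Fintype.card_prod, Fintype.card_fin] at h1 h2
    rcases le_total m n with h | h
    · rw [min_eq_left (by exact_mod_cast h), pow_two]
      exact_mod_cast h1
    · rw [min_eq_right (by exact_mod_cast h), pow_two]
      exact_mod_cast h2
  obtain ⟨w, h1, h2, h3, h4⟩ := exists_sum_sqrt_sqSingularValue_le (realign ρ) (maxEntangled m)
    (maxEntangled n) (norm_maxEntangled hm) (norm_maxEntangled hn)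
    ((√(m : ℝ))⁻¹ * (√(n : ℝ))⁻¹) (by rw [inner_maxEntangled_realign, htr, mul_one]; rfl)
  rw [hp] at h3 h4
  refine ⟨_, w, by positivity, ?_, h1, h2.trans hrank, h3, h4.trans ?_⟩
  · have hm' : (m : ℝ) ≠ 0 := by positivity
    have hn' : (n : ℝ) ≠ 0 := by positivity
    rw [mul_pow, inv_pow, inv_pow, Real.sq_sqrt (by positivity), Real.sq_sqrt (by positivity)]
    field_simp
  · gcongr

lemma sum_eigenvalues_eq_one {ι : Type*} [Fintype ι] [DecidableEq ι] {ρ : Matrix ι ι ℂ}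
    (hρ : ρ.IsHermitian) (htr : ρ.trace = 1) : ∑ i, hρ.eigenvalues i = 1 := by
  have := hρ.trace_eq_sum_eigenvalues
  rw [htr] at this
  simpa using (congrArg Complex.re this).symm

lemma traceNorm_realign_le_one_of_min_eq_one {m n : ℕ} (h : min m n = 1)
    (ρ : Matrix (Fin m × Fin n) (Fin m × Fin n) ℂ) (hρ : ρ.PosSemidef) (htr : ρ.trace = 1) :
    traceNorm (realign ρ) ≤ 1 := by
  obtain ⟨a, w, -, -, -, hw, ha, hle⟩ := traceNorm_realign_le_of_min ρ (by omega) (by omega)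
    hρ.1 htr
  rw [← Nat.cast_min, h] at hw hle
  have hp : ∑ i, hρ.1.eigenvalues i ^ 2 ≤ 1 := by
    have h1 := sum_eigenvalues_eq_one hρ.1 htr
    calc _ ≤ ∑ i, hρ.1.eigenvalues i := Finset.sum_le_sum fun i hi => by
          have := Finset.single_le_sum (fun j _ => hρ.eigenvalues_nonneg j) hi
          nlinarith [hρ.eigenvalues_nonneg i]
      _ = 1 := h1
  set p := ∑ i, hρ.1.eigenvalues i ^ 2
  refine hle.trans ?_
  have e1 := Real.sq_sqrt (sub_nonneg.mpr hw)
  have e2 := Real.sq_sqrt (sub_nonneg.mpr ha)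
  push_cast at *
  nlinarith [sq_nonneg (√(1 ^ 2 - w ^ 2) - √(p - a ^ 2)), sq_nonneg (w - a)]

lemma traceNorm_realign_le_one_of_six_le {m n : ℕ} (hm : 2 ≤ m) (hn : 2 ≤ n) (hmn : 6 ≤ m * n)
    (ρ : Matrix (Fin m × Fin n) (Fin m × Fin n) ℂ) (hρ : ρ.PosSemidef) (htr : ρ.trace = 1)
    (hppt : AbsolutelyPPT ρ) : traceNorm (realign ρ) ≤ 1 := by
  obtain ⟨a, w, ha0, ha2, hw1, hw, ha, hle⟩ := traceNorm_realign_le_of_min ρ (by omega) (by omega)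
    hρ.1 htr
  have hcard : Fintype.card (Fin m × Fin n) = m * n := by simp
  have hp := sum_sq_le_of_sq_sub_le (by rw [hcard]; omega) hρ.1.eigenvalues hρ.eigenvalues_nonneg
    (sum_eigenvalues_eq_one hρ.1 htr) (hppt.eigenvalues_sq_sub_le hm hn hρ.1)
  rw [hcard, Nat.cast_mul] at hp
  refine hle.trans (sqrt_mul_sqrt_add_le_one ?_ hp ha0 ha2 hw1 hw)
  rw [← Nat.cast_min]
  have h6 : (6 : ℝ) ≤ m * n := by exact_mod_cast hmn
  obtain h | h : min m n = 2 ∨ 3 ≤ min m n := by omega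
  · exact Or.inl ⟨by rw [h]; norm_num, h6⟩
  · refine Or.inr ⟨by exact_mod_cast h, ?_⟩
    rw [pow_two]
    exact_mod_cast Nat.mul_le_mul (min_le_left m n) (min_le_right m n)

/-- The superoperator on `2 × 2` matrices encoded by `W` preserves Hermiticity. -/
def HermitianPreserving (W : Matrix (Fin 2 × Fin 2) (Fin 2 × Fin 2) ℂ) : Prop :=
  ∀ i j k l, W (j, i) (l, k) = star (W (i, j) (k, l))

lemma one_sub_mul_add_one_sub_mul_ge {x y r s z : ℝ} (hx : x ^ 2 ≤ 1) (hy : y ^ 2 ≤ 1)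
    (hr : 0 ≤ r) (hs : 0 ≤ s) (hzrs : z ^ 2 ≤ r * s) :
    2 * √((1 - x) * (1 - y)) * z ≤ (1 - x) * r + (1 - y) * s := by
  have hx' : 0 ≤ 1 - x := by nlinarith
  have hy' : 0 ≤ 1 - y := by nlinarith
  have h1 := Real.sq_sqrt (mul_nonneg hx' hy')
  have h2 := Real.sqrt_nonneg ((1 - x) * (1 - y))
  set t := √((1 - x) * (1 - y))
  refine abs_le_of_sq_le_sq' ?_ (by positivity) |>.2
  have h3 : t ^ 2 * z ^ 2 ≤ (1 - x) * (1 - y) * (r * s) := by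
    rw [h1]; exact mul_le_mul_of_nonneg_left hzrs (mul_nonneg hx' hy')
  nlinarith [sq_nonneg ((1 - x) * r - (1 - y) * s)]

lemma one_le_sqrt_add_sqrt_of_orthogonal {x y z w : ℝ} (h1 : x ^ 2 + y ^ 2 = 1)
    (h2 : z ^ 2 + w ^ 2 = 1) (h3 : x * z + y * w = 0) :
    1 ≤ √((1 - x) * (1 - w)) + √((1 - y) * (1 - z)) := by
  have hxw : (w - x) * (w + x) = 0 := by
    have : w ^ 2 = x ^ 2 := by
      linear_combination (-w ^ 2) * h1 + x ^ 2 * h2 + (y * w - x * z) * h3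
    linear_combination this
  have hx : |x| ≤ 1 := abs_le_of_sq_le_sq (by nlinarith) zero_le_one
  have hy : |y| ≤ 1 := abs_le_of_sq_le_sq (by nlinarith) zero_le_one
  have hx' := abs_le.mp hx
  have hy' := abs_le.mp hy
  by_cases hx0 : x = 0
  · have hw0 : w = 0 := by
      subst hx0
      nlinarith
    have := Real.sqrt_nonneg ((1 - y) * (1 - z))
    simp only [hx0, hw0, sub_zero, mul_one, Real.sqrt_one]
    linarith
  rcases mul_eq_zero.mp hxw with h | h
  · have hw : w = x := by linarith
    have hz : z = -y := by
      have : x * (z + y) = 0 := by rw [hw] at h3; linear_combination h3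
      linarith [(mul_eq_zero.mp this).resolve_left hx0]
    have e : (1 - y) * (1 - z) = x ^ 2 := by rw [hz]; linear_combination -h1
    rw [hw, e, Real.sqrt_mul_self (by linarith), Real.sqrt_sq_eq_abs]
    linarith [le_abs_self x]
  · have hw : w = -x := by linarith
    have hz : z = y := by
      have : x * (z - y) = 0 := by rw [hw] at h3; linear_combination h3
      linarith [(mul_eq_zero.mp this).resolve_left hx0]
    have e : (1 - x) * (1 - w) = y ^ 2 := by rw [hw]; linear_combination -h1
    rw [hz, e, Real.sqrt_mul_self (by linarith), Real.sqrt_sq_eq_abs]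
    linarith [le_abs_self y]

section TwoByTwo

variable {ρ W : Matrix (Fin 2 × Fin 2) (Fin 2 × Fin 2) ℂ}

lemma exists_real_diagonal_of_rows (hW : W ∈ unitaryGroup (Fin 2 × Fin 2) ℂ)
    (hH : HermitianPreserving W) (hrow : ∀ i, W (i, i) (0, 1) = 0) :
    ∃ (x : Fin 2 → Fin 2 → ℝ) (p q : ℂ), (∀ i k, W (i, i) (k, k) = x i k) ∧
      x 0 0 ^ 2 + x 0 1 ^ 2 = 1 ∧ x 1 0 ^ 2 + x 1 1 ^ 2 = 1 ∧
      x 0 0 * x 1 0 + x 0 1 * x 1 1 = 0 ∧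
      (∀ k, W (0, 1) (k, k) = 0) ∧ W (0, 1) (0, 1) = p ∧ W (0, 1) (1, 0) = q ∧
      ‖p‖ + ‖q‖ = 1 := by
  have hrow' : ∀ i, W (i, i) (1, 0) = 0 := fun i => by rw [hH i i 0 1, hrow, star_zero]
  have hreal : ∀ i k, W (i, i) (k, k) = ((W (i, i) (k, k)).re : ℂ) := fun i k =>
    (Complex.conj_eq_iff_re.mp (hH i i k k).symm).symm
  have hr := mem_unitaryGroup_iff.mp hW
  have hc := mem_unitaryGroup_iff'.mp hW
  have er : ∀ a b, ∑ i, ∑ k, W a (i, k) * star (W b (i, k)) = if a = b then 1 else 0 := by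
    intro a b
    have := congrFun (congrFun hr a) b
    rwa [star_eq_conjTranspose, mul_apply, Fintype.sum_prod_type, one_apply] at this
  have ec : ∀ a b, ∑ i, ∑ k, star (W (i, k) a) * W (i, k) b = if a = b then 1 else 0 := by
    intro a b
    have := congrFun (congrFun hc a) b
    rwa [star_eq_conjTranspose, mul_apply, Fintype.sum_prod_type, one_apply] at this
  simp only [Fin.sum_univ_two] at er ec
  have r00 := er (0, 0) (0, 0)
  have r11 := er (1, 1) (1, 1)
  have r01 := er (0, 0) (1, 1)
  have c0 := ec (0, 0) (0, 0)
  have c1 := ec (1, 1) (1, 1)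
  have g0 := er (0, 1) (0, 1)
  have g1 := er (0, 1) (1, 0)
  rw [hH 0 1 0 0] at c0
  rw [hH 0 1 1 1] at c1
  rw [hH 0 1 0 0, hH 0 1 0 1, hH 0 1 1 0, hH 0 1 1 1] at g1
  rw [hreal 0 0, hreal 1 0] at c0 r01
  rw [hreal 0 1, hreal 1 1] at c1 r01
  rw [hreal 0 0, hreal 0 1] at r00
  rw [hreal 1 0, hreal 1 1] at r11
  simp only [hrow, hrow', star_zero, mul_zero, add_zero, zero_add, Complex.star_def,
    Complex.conj_ofReal, Complex.conj_conj, Complex.mul_conj', Complex.conj_mul', if_true,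
    Prod.mk.injEq, zero_ne_one, and_self, false_and, if_false] at r00 r11 r01 c0 c1 g0 g1
  norm_cast at r00 r11 r01 c0 c1 g0
  have hdet : (W (0, 0) (0, 0)).re ^ 2 + (W (1, 1) (0, 0)).re ^ 2 = 1 := by
    generalize (W (0, 0) (0, 0)).re = a at *
    generalize (W (0, 0) (1, 1)).re = b at *
    generalize (W (1, 1) (0, 0)).re = c at *
    generalize (W (1, 1) (1, 1)).re = d at *
    have : c ^ 2 = b ^ 2 := by
      linear_combination (-c ^ 2) * r00 + b ^ 2 * r11 + (a * c - b * d) * r01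
    linear_combination r00 + this
  have z0 : W (0, 1) (0, 0) = 0 := by
    rw [← norm_eq_zero, ← sq_eq_zero_iff]
    linarith
  have z1 : W (0, 1) (1, 1) = 0 := by
    rw [← norm_eq_zero, ← sq_eq_zero_iff]
    linarith
  refine ⟨fun i k => (W (i, i) (k, k)).re, _, _, hreal, ?_, ?_, ?_, ?_, rfl, rfl, ?_⟩
  · linear_combination r00
  · linear_combination r11
  · linear_combination r01
  · exact Fin.forall_fin_two.mpr ⟨z0, z1⟩
  · rw [z0, z1, norm_zero] at g0
    have hpq : W (0, 1) (0, 1) * W (0, 1) (1, 0) = 0 := by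
      rw [z0, z1] at g1
      linear_combination g1 / 2
    have hn : ‖W (0, 1) (0, 1)‖ * ‖W (0, 1) (1, 0)‖ = 0 := by rw [← norm_mul, hpq, norm_zero]
    rw [← sq_eq_sq₀ (by positivity) zero_le_one]
    linear_combination g0 + 2 * hn

lemma re_trace_le_of_rows (hρ : ρ.PosSemidef) (hppt : AbsolutelyPPT ρ)
    (hW : W ∈ unitaryGroup (Fin 2 × Fin 2) ℂ)
    (hH : HermitianPreserving W) (hrow : ∀ i, W (i, i) (0, 1) = 0) :
    (Wᴴ * realign ρ).trace.re ≤ ρ.trace.re := by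
  obtain ⟨x, p, q, hx, h0, h1, h01, hz, hp, hq, hpq⟩ := exists_real_diagonal_of_rows hW hH hrow
  have hrow' : ∀ i, W (i, i) (1, 0) = 0 := fun i => by rw [hH i i 0 1, hrow, star_zero]
  have hz' : ∀ k, W (1, 0) (k, k) = 0 := fun k => by rw [hH 0 1 k k, hz, star_zero]
  have hp' : W (1, 0) (1, 0) = star p := by rw [hH 0 1 0 1, hp]
  have hq' : W (1, 0) (0, 1) = star q := by rw [hH 0 1 1 0, hq]
  have hd : ∀ a, 0 ≤ (ρ a a).re := fun a => (Complex.le_def.mp hρ.diag_nonneg).1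
  have htr : (Wᴴ * realign ρ).trace.re = ∑ i, ∑ k, x i k * (ρ (i, k) (i, k)).re +
      2 * (star p * ρ (0, 0) (1, 1)).re + 2 * (star q * ρ (0, 1) (1, 0)).re := by
    have e1 : ρ (1, 1) (0, 0) = star (ρ (0, 0) (1, 1)) := (hρ.1.apply _ _).symm
    have e2 : ρ (1, 0) (0, 1) = star (ρ (0, 1) (1, 0)) := (hρ.1.apply _ _).symm
    simp only [trace, diag_apply, mul_apply, Fintype.sum_prod_type, Fin.sum_univ_two,
      conjTranspose_apply, realign, of_apply, hx, hrow, hrow', hz, hz', hp, hq, hp', hq', e1, e2]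
    simp
    ring
  have b1 : ‖ρ (0, 0) (1, 1)‖ ^ 2 ≤ (ρ (0, 0) (0, 0)).re * (ρ (1, 1) (1, 1)).re :=
    hρ.norm_sq_apply_le _ _
  have b2 : ‖ρ (0, 0) (1, 1)‖ ^ 2 ≤ (ρ (0, 1) (0, 1)).re * (ρ (1, 0) (1, 0)).re :=
    hppt.norm_sq_apply_le _ _ _ _
  have b3 : ‖ρ (0, 1) (1, 0)‖ ^ 2 ≤ (ρ (0, 0) (0, 0)).re * (ρ (1, 1) (1, 1)).re :=
    hppt.norm_sq_apply_le _ _ _ _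
  have b4 : ‖ρ (0, 1) (1, 0)‖ ^ 2 ≤ (ρ (0, 1) (0, 1)).re * (ρ (1, 0) (1, 0)).re :=
    hρ.norm_sq_apply_le _ _
  have np : (star p * ρ (0, 0) (1, 1)).re ≤ ‖p‖ * ‖ρ (0, 0) (1, 1)‖ :=
    (Complex.re_le_norm _).trans (by rw [norm_mul, norm_star])
  have nq : (star q * ρ (0, 1) (1, 0)).re ≤ ‖q‖ * ‖ρ (0, 1) (1, 0)‖ :=
    (Complex.re_le_norm _).trans (by rw [norm_mul, norm_star])
  obtain ⟨z, hz0, hz1, hz2, hz3, hz4⟩ : ∃ z : ℝ, 0 ≤ z ∧ ‖ρ (0, 0) (1, 1)‖ ≤ z ∧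
      ‖ρ (0, 1) (1, 0)‖ ≤ z ∧ z ^ 2 ≤ (ρ (0, 0) (0, 0)).re * (ρ (1, 1) (1, 1)).re ∧
      z ^ 2 ≤ (ρ (0, 1) (0, 1)).re * (ρ (1, 0) (1, 0)).re := by
    rcases le_total ‖ρ (0, 0) (1, 1)‖ ‖ρ (0, 1) (1, 0)‖ with h | h
    · exact ⟨_, norm_nonneg _, h, le_rfl, b3, b4⟩
    · exact ⟨_, norm_nonneg _, le_rfl, h, b1, b2⟩
  have hoff : (star p * ρ (0, 0) (1, 1)).re + (star q * ρ (0, 1) (1, 0)).re ≤ z := by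
    nlinarith [norm_nonneg p, norm_nonneg q, mul_le_mul_of_nonneg_left hz1 (norm_nonneg p),
      mul_le_mul_of_nonneg_left hz2 (norm_nonneg q)]
  have c1 := one_sub_mul_add_one_sub_mul_ge (x := x 0 0) (y := x 1 1) (by nlinarith)
    (by nlinarith) (hd _) (hd _) hz3
  have c2 := one_sub_mul_add_one_sub_mul_ge (x := x 0 1) (y := x 1 0) (by nlinarith)
    (by nlinarith) (hd _) (hd _) hz4
  have c3 := one_le_sqrt_add_sqrt_of_orthogonal h0 h1 h01
  rw [htr]
  simp only [trace, diag_apply, Fintype.sum_prod_type, Fin.sum_univ_two, Complex.add_re]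
  nlinarith [mul_le_mul_of_nonneg_right c3 hz0]

end TwoByTwo

section LocalUnitary

open Kronecker

variable {ρ W : Matrix (Fin 2 × Fin 2) (Fin 2 × Fin 2) ℂ} {U : Matrix (Fin 2) (Fin 2) ℂ}

/-- The matrix of the map `X ↦ U X Uᴴ` on vectorized matrices. -/
def conjKronecker (U : Matrix (Fin 2) (Fin 2) ℂ) : Matrix (Fin 2 × Fin 2) (Fin 2 × Fin 2) ℂ :=
  U ⊗ₖ U.map star

lemma conjKronecker_mem_unitaryGroup (hU : U ∈ unitaryGroup (Fin 2) ℂ) :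
    conjKronecker U ∈ unitaryGroup (Fin 2 × Fin 2) ℂ :=
  kronecker_mem_unitary hU (map_star_mem_unitaryGroup_iff.mpr hU)

lemma realign_conj_kronecker_one :
    realign ((U ⊗ₖ 1) * ρ * (U ⊗ₖ 1)ᴴ) = conjKronecker U * realign ρ := by
  ext ⟨i, j⟩ ⟨k, l⟩
  simp only [realign, conjKronecker, of_apply, mul_apply, Fintype.sum_prod_type, Fin.sum_univ_two,
    conjTranspose_apply, kronecker_apply, map_apply, one_apply, star_mul', apply_ite star, star_one,
    star_zero]
  fin_cases k <;> fin_cases l <;> simp <;> ring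

lemma realign_conj_one_kronecker :
    realign ((1 ⊗ₖ U) * ρ * (1 ⊗ₖ U)ᴴ) = realign ρ * (conjKronecker U)ᵀ := by
  ext ⟨i, j⟩ ⟨k, l⟩
  simp only [realign, conjKronecker, of_apply, mul_apply, Fintype.sum_prod_type, Fin.sum_univ_two,
    conjTranspose_apply, transpose_apply, kronecker_apply, map_apply, one_apply, star_mul',
    apply_ite star, star_one, star_zero]
  fin_cases i <;> fin_cases j <;> simp <;> ring

lemma HermitianPreserving.conjKronecker_mul (hH : HermitianPreserving W) :
    HermitianPreserving (conjKronecker U * W) := by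
  intro i j k l
  simp only [conjKronecker, mul_apply, Fintype.sum_prod_type, Fin.sum_univ_two, kronecker_apply,
    map_apply, star_add, star_mul', star_star, ← hH _ _ _ _]
  ring

lemma HermitianPreserving.mul_conjKronecker_transpose (hH : HermitianPreserving W) :
    HermitianPreserving (W * (conjKronecker U)ᵀ) := by
  intro i j k l
  simp only [conjKronecker, mul_apply, Fintype.sum_prod_type, Fin.sum_univ_two, kronecker_apply,
    transpose_apply, map_apply, star_add, star_mul', star_star, ← hH _ _ _ _]
  ring

lemma trace_conj_of_mem_unitaryGroup {ι : Type*} [Fintype ι] [DecidableEq ι] {V : Matrix ι ι ℂ}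
    (hV : V ∈ unitaryGroup ι ℂ) (M : Matrix ι ι ℂ) : (V * M * Vᴴ).trace = M.trace := by
  rw [trace_mul_comm, ← Matrix.mul_assoc, ← star_eq_conjTranspose, mem_unitaryGroup_iff'.mp hV,
    Matrix.one_mul]

/-- `W` certifies the realignment bound on all absolutely PPT matrices. -/
def RealignmentBound (W : Matrix (Fin 2 × Fin 2) (Fin 2 × Fin 2) ℂ) : Prop :=
  ∀ ρ : Matrix (Fin 2 × Fin 2) (Fin 2 × Fin 2) ℂ, ρ.PosSemidef → AbsolutelyPPT ρ →
    (Wᴴ * realign ρ).trace.re ≤ ρ.trace.re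

lemma RealignmentBound.of_conjKronecker_mul (hU : U ∈ unitaryGroup (Fin 2) ℂ)
    (h : RealignmentBound (conjKronecker U * W)) : RealignmentBound W := by
  intro ρ hρ hppt
  have hU' : U ⊗ₖ (1 : Matrix (Fin 2) (Fin 2) ℂ) ∈ unitaryGroup (Fin 2 × Fin 2) ℂ :=
    kronecker_mem_unitary hU (one_mem _)
  have := h _ (hρ.mul_mul_conjTranspose_same (U ⊗ₖ 1)) (hppt.conj hU')
  have hK := mem_unitaryGroup_iff'.mp (conjKronecker_mem_unitaryGroup hU)
  rwa [trace_conj_of_mem_unitaryGroup hU', realign_conj_kronecker_one, conjTranspose_mul,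
    Matrix.mul_assoc, ← Matrix.mul_assoc (conjKronecker U)ᴴ,
    ← star_eq_conjTranspose (conjKronecker U), hK, Matrix.one_mul] at this

lemma RealignmentBound.of_mul_conjKronecker_transpose (hU : U ∈ unitaryGroup (Fin 2) ℂ)
    (h : RealignmentBound (W * (conjKronecker U)ᵀ)) : RealignmentBound W := by
  intro ρ hρ hppt
  have hU' : (1 : Matrix (Fin 2) (Fin 2) ℂ) ⊗ₖ U ∈ unitaryGroup (Fin 2 × Fin 2) ℂ :=
    kronecker_mem_unitary (one_mem _) hU
  have := h _ (hρ.mul_mul_conjTranspose_same (1 ⊗ₖ U)) (hppt.conj hU')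
  have hK := mem_unitaryGroup_iff.mp
    (transpose_mem_unitaryGroup_iff.mpr (conjKronecker_mem_unitaryGroup hU))
  rwa [trace_conj_of_mem_unitaryGroup hU', realign_conj_one_kronecker, conjTranspose_mul,
    trace_mul_comm, ← Matrix.mul_assoc, Matrix.mul_assoc (realign ρ),
    ← star_eq_conjTranspose (conjKronecker U)ᵀ, hK, Matrix.mul_one, trace_mul_comm] at this

lemma Matrix.IsHermitian.exists_conj_eq_diagonal {ι : Type*} [Fintype ι] [DecidableEq ι]
    {A : Matrix ι ι ℂ} (hA : A.IsHermitian) :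
    ∃ U ∈ unitaryGroup ι ℂ, ∃ a : ι → ℂ, U * A * Uᴴ = diagonal a := by
  refine ⟨star hA.eigenvectorUnitary, (star hA.eigenvectorUnitary).2,
    RCLike.ofReal ∘ hA.eigenvalues, ?_⟩
  have := hA.conjStarAlgAut_star_eigenvectorUnitary
  rw [Unitary.conjStarAlgAut_star_apply] at this
  rw [star_eq_conjTranspose, conjTranspose_conjTranspose]
  exact this

/-- The image of the identity under the superoperator encoded by `W`. -/
def imageOne (W : Matrix (Fin 2 × Fin 2) (Fin 2 × Fin 2) ℂ) : Matrix (Fin 2) (Fin 2) ℂ :=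
  of fun i j => ∑ k, W (i, j) (k, k)

/-- The `(i, i)` row of `W`, viewed as a matrix. -/
def diagRow (W : Matrix (Fin 2 × Fin 2) (Fin 2 × Fin 2) ℂ) (i : Fin 2) :
    Matrix (Fin 2) (Fin 2) ℂ :=
  of fun k l => W (i, i) (k, l)

lemma imageOne_conjKronecker_mul : imageOne (conjKronecker U * W) = U * imageOne W * Uᴴ := by
  ext i j
  simp only [imageOne, conjKronecker, of_apply, mul_apply, Fintype.sum_prod_type, Fin.sum_univ_two,
    conjTranspose_apply, kronecker_apply, map_apply]
  ring

lemma diagRow_mul_conjKronecker_transpose (i : Fin 2) :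
    diagRow (W * (conjKronecker U)ᵀ) i = U * diagRow W i * Uᴴ := by
  ext k l
  simp only [diagRow, conjKronecker, of_apply, mul_apply, Fintype.sum_prod_type, Fin.sum_univ_two,
    conjTranspose_apply, transpose_apply, kronecker_apply, map_apply]
  ring

lemma sum_smul_diagRow_eq_one (hW : W ∈ unitaryGroup (Fin 2 × Fin 2) ℂ)
    (hH : HermitianPreserving W) {a : Fin 2 → ℂ} (ha : imageOne W = diagonal a) :
    ∑ i, a i • diagRow W i = 1 := by
  ext k l
  have hc : ∀ r, ∑ i, ∑ j, star (W (i, j) (l, k)) * W (i, j) (r, r) =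
      (1 : Matrix (Fin 2 × Fin 2) (Fin 2 × Fin 2) ℂ) (l, k) (r, r) := by
    intro r
    rw [← mem_unitaryGroup_iff'.mp hW, star_eq_conjTranspose, mul_apply, Fintype.sum_prod_type]
    rfl
  have ha' : ∀ i j, W (i, j) (0, 0) + W (i, j) (1, 1) = diagonal a i j := fun i j => by
    rw [← ha, imageOne, of_apply, Fin.sum_univ_two]
  have h00 := ha' 0 0
  have h01 := ha' 0 1
  have h10 := ha' 1 0
  have h11 := ha' 1 1
  simp only [← hH _ _ _ _, Fin.sum_univ_two] at hc
  simp only [diagRow, Fin.sum_univ_two, Matrix.add_apply, Matrix.smul_apply, of_apply, smul_eq_mul]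
  simp only [diagonal_apply, if_true, zero_ne_one, one_ne_zero, if_false] at h00 h01 h10 h11
  have e : (1 : Matrix (Fin 2) (Fin 2) ℂ) k l =
      (1 : Matrix (Fin 2 × Fin 2) (Fin 2 × Fin 2) ℂ) (l, k) (0, 0) +
      (1 : Matrix (Fin 2 × Fin 2) (Fin 2 × Fin 2) ℂ) (l, k) (1, 1) := by
    fin_cases k <;> fin_cases l <;> simp [one_apply]
  rw [e, ← hc, ← hc]
  linear_combination -W (0, 0) (k, l) * h00 - W (1, 0) (k, l) * h01 - W (0, 1) (k, l) * h10 -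
    W (1, 1) (k, l) * h11

lemma RealignmentBound.of_imageOne_eq_diagonal (hW : W ∈ unitaryGroup (Fin 2 × Fin 2) ℂ)
    (hH : HermitianPreserving W) {a : Fin 2 → ℂ} (ha : imageOne W = diagonal a) :
    RealignmentBound W := by
  have hsum := sum_smul_diagRow_eq_one hW hH ha
  obtain ⟨i, hi⟩ : ∃ i, a i ≠ 0 := by
    by_contra! h0
    simp [h0] at hsum
  obtain ⟨j, hij, hj⟩ : ∃ j, i ≠ j ∧ ∀ f : Fin 2 → Matrix (Fin 2) (Fin 2) ℂ,
      ∑ x, f x = f i + f j := by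
    fin_cases i
    · exact ⟨1, by simp, fun f => by simp⟩
    · exact ⟨0, by simp, fun f => by simp [add_comm]⟩
  have hR : (diagRow W j).IsHermitian := IsHermitian.ext fun k l => (hH j j l k).symm
  obtain ⟨U, hU, b, hb⟩ := hR.exists_conj_eq_diagonal
  refine .of_mul_conjKronecker_transpose hU fun ρ hρ hppt => re_trace_le_of_rows hρ hppt
    (mul_mem hW (transpose_mem_unitaryGroup_iff.mpr (conjKronecker_mem_unitaryGroup hU)))
    hH.mul_conjKronecker_transpose fun x => ?_
  have hd := fun x =>
    congrFun (congrFun (diagRow_mul_conjKronecker_transpose (W := W) (U := U) x) 0) 1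
  have hj0 : diagRow (W * (conjKronecker U)ᵀ) j 0 1 = 0 := by rw [hd, hb]; simp
  have hi0 : diagRow (W * (conjKronecker U)ᵀ) i 0 1 = 0 := by
    have h1 : U * (a i • diagRow W i + a j • diagRow W j) * Uᴴ = 1 := by
      rw [← hj fun x => a x • diagRow W x, hsum, Matrix.mul_one]
      exact mem_unitaryGroup_iff.mp hU
    rw [Matrix.mul_add, Matrix.add_mul, Matrix.mul_smul, Matrix.smul_mul, Matrix.mul_smul,
      Matrix.smul_mul, hb] at h1
    have h2 := congrFun (congrFun h1 0) 1
    rw [hd]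
    simpa [hi] using h2
  have : x = i ∨ x = j := by omega
  rcases this with rfl | rfl
  exacts [hi0, hj0]

lemma realignmentBound_of_hermitianPreserving (hW : W ∈ unitaryGroup (Fin 2 × Fin 2) ℂ)
    (hH : HermitianPreserving W) : RealignmentBound W := by
  have hA : (imageOne W).IsHermitian := IsHermitian.ext fun i j => by
    simp only [imageOne, of_apply, star_sum]
    exact Finset.sum_congr rfl fun k _ => (hH j i k k).symm
  obtain ⟨U, hU, a, ha⟩ := hA.exists_conj_eq_diagonal
  exact .of_conjKronecker_mul hU (.of_imageOne_eq_diagonal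
    (mul_mem (conjKronecker_mem_unitaryGroup hU) hW) hH.conjKronecker_mul
    (imageOne_conjKronecker_mul.trans ha))

end LocalUnitary

lemma exists_mem_unitaryGroup_trace_eq {𝕜 ι : Type*} [RCLike 𝕜] [Fintype ι] [DecidableEq ι]
    (T : Matrix ι ι 𝕜) :
    ∃ O ∈ unitaryGroup ι 𝕜, (Oᴴ * T).trace = ∑ i, (√(sqSingularValue T i) : 𝕜) := by
  obtain ⟨u, hu⟩ := (orthonormal_leftSingular T).exists_orthonormalBasis_extension_of_card_eq
    (by simp)
  have hterm : ∀ i, inner 𝕜 (u i) (WithLp.toLp 2 (T *ᵥ (rightSingularBasis T i).ofLp)) =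
      (√(sqSingularValue T i) : 𝕜) := by
    intro i
    by_cases h : sqSingularValue T i = 0
    · have h0 := inner_mulVec_rightSingularBasis T i i
      rw [if_pos rfl, h, RCLike.ofReal_zero, inner_self_eq_zero] at h0
      rw [h0, inner_zero_right, h, Real.sqrt_zero, RCLike.ofReal_zero]
    · rw [hu i h, inner_leftSingular_mulVec]
  have hmem := (EuclideanSpace.basisFun ι 𝕜).toMatrix_orthonormalBasis_mem_unitary
  refine ⟨_ * star _, mul_mem (hmem u) (Unitary.star_mem (hmem (rightSingularBasis T))), ?_⟩
  simp_rw [← hterm]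
  rw [conjTranspose_mul, star_eq_conjTranspose, conjTranspose_conjTranspose, Matrix.mul_assoc,
    trace_mul_comm, Matrix.mul_assoc, trace]
  refine Finset.sum_congr rfl fun i _ => ?_
  rw [EuclideanSpace.inner_eq_star_dotProduct, dotProduct_comm]
  rfl

lemma map_ofReal_conjTranspose {d e : Type*} (T : Matrix d e ℝ) :
    Tᴴ.map Complex.ofRealHom = (T.map Complex.ofRealHom)ᴴ :=
  conjTranspose_map _ fun x => (Complex.conj_ofReal x).symm

lemma traceNorm_eq_sum_of_map_ofReal {ι : Type*} [Fintype ι] [DecidableEq ι] {K Q : Matrix ι ι ℂ}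
    {T : Matrix ι ι ℝ} (hQ : Q ∈ unitaryGroup ι ℂ) (hK : K = Q * T.map Complex.ofRealHom * Qᴴ) :
    traceNorm K = ∑ i, √(sqSingularValue T i) := by
  have hchar : (Kᴴ * K).charpoly = (Tᴴ * T).charpoly.map Complex.ofRealHom := by
    have hQ' : Qᴴ * Q = 1 := mem_unitaryGroup_iff'.mp hQ
    have : Kᴴ * K = Q * ((Tᴴ * T).map Complex.ofRealHom * Qᴴ) := by
      rw [hK, Matrix.map_mul, map_ofReal_conjTranspose]
      simp only [conjTranspose_mul, conjTranspose_conjTranspose, Matrix.mul_assoc]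
      rw [← Matrix.mul_assoc Qᴴ Q, hQ', Matrix.one_mul]
    rw [this, charpoly_mul_comm, Matrix.mul_assoc, hQ', Matrix.mul_one, charpoly_map]
  have h1 := (posSemidef_conjTranspose_mul_self K).1.roots_charpoly_eq_eigenvalues
  have h2 : (Kᴴ * K).charpoly.roots =
      Multiset.map (fun i => (sqSingularValue T i : ℂ)) Finset.univ.val := by
    rw [hchar, (posSemidef_conjTranspose_mul_self T).1.charpoly_eq, Polynomial.map_prod,
      Polynomial.roots_prod]
    · simp [sqSingularValue]
    · simp [Finset.prod_ne_zero_iff, Polynomial.X_sub_C_ne_zero]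
  have h3 := congrArg (fun s : Multiset ℂ => (s.map fun z => √z.re).sum) (h1.symm.trans h2)
  simpa [Multiset.map_map, traceNorm] using h3

/-- The matrix exchanging the two indices of a vectorized matrix. -/
def swapMatrix : Matrix (Fin 2 × Fin 2) (Fin 2 × Fin 2) ℂ :=
  of fun p q => if p = q.swap then 1 else 0

/-- A unitary matrix whose columns are Hermitian matrices. -/
def hermitianFrame : Matrix (Fin 2 × Fin 2) (Fin 2 × Fin 2) ℂ :=
  ((1 + Complex.I) / 2) • 1 + ((1 - Complex.I) / 2) • swapMatrix

section HermitianFrame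

variable {K : Matrix (Fin 2 × Fin 2) (Fin 2 × Fin 2) ℂ}

lemma swapMatrix_mul_apply (p q : Fin 2 × Fin 2) : (swapMatrix * K) p q = K p.swap q := by
  simp [swapMatrix, mul_apply, ← Prod.swap_eq_iff_eq_swap]

lemma mul_swapMatrix_apply (p q : Fin 2 × Fin 2) : (K * swapMatrix) p q = K p q.swap := by
  simp [swapMatrix, mul_apply]

lemma swapMatrix_mul_self : swapMatrix * swapMatrix = 1 := by
  ext p q
  rw [swapMatrix_mul_apply]
  simp [swapMatrix, one_apply]

lemma swapMatrix_conjTranspose : swapMatrixᴴ = swapMatrix := by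
  ext p q
  simp only [swapMatrix, conjTranspose_apply, of_apply, apply_ite star, star_one, star_zero]
  exact if_congr (by rw [← Prod.swap_eq_iff_eq_swap, eq_comm]) rfl rfl

lemma swapMatrix_map : swapMatrix.map (starRingEnd ℂ) = swapMatrix := by
  ext p q
  simp [swapMatrix, apply_ite (starRingEnd ℂ)]

lemma hermitianPreserving_iff :
    HermitianPreserving K ↔ K.map (starRingEnd ℂ) = swapMatrix * K * swapMatrix := by
  refine ⟨fun h => ?_, fun h i j k l => ?_⟩
  · ext ⟨i, j⟩ ⟨k, l⟩
    rw [mul_swapMatrix_apply, swapMatrix_mul_apply]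
    exact (h i j k l).symm
  · have := congrFun (congrFun h (i, j)) (k, l)
    rw [mul_swapMatrix_apply, swapMatrix_mul_apply] at this
    exact this.symm

lemma hermitianFrame_conjTranspose : hermitianFrameᴴ =
    ((1 - Complex.I) / 2) • 1 + ((1 + Complex.I) / 2) • swapMatrix := by
  rw [hermitianFrame, conjTranspose_add, conjTranspose_smul, conjTranspose_smul,
    conjTranspose_one, swapMatrix_conjTranspose]
  simp [sub_eq_add_neg]

lemma hermitianFrame_map :
    hermitianFrame.map (starRingEnd ℂ) = swapMatrix * hermitianFrame := by
  have h : hermitianFrame.map (starRingEnd ℂ) = (hermitianFrameᴴ)ᵀ := rfl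
  have hT : swapMatrixᵀ = swapMatrix := by
    rw [← swapMatrix_map]
    exact swapMatrix_conjTranspose.trans swapMatrix_map.symm
  rw [h, hermitianFrame_conjTranspose, hermitianFrame, transpose_add, transpose_smul,
    transpose_smul, hT, transpose_one, Matrix.mul_add, Matrix.mul_smul, Matrix.mul_smul,
    swapMatrix_mul_self, Matrix.mul_one, add_comm]

lemma hermitianFrame_mem_unitaryGroup : hermitianFrame ∈ unitaryGroup (Fin 2 × Fin 2) ℂ := by
  rw [mem_unitaryGroup_iff', star_eq_conjTranspose, hermitianFrame_conjTranspose, hermitianFrame]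
  simp only [Matrix.add_mul, Matrix.mul_add, smul_mul_smul_comm, Matrix.one_mul, Matrix.mul_one,
    swapMatrix_mul_self]
  have h1 : (1 - Complex.I) / 2 * ((1 + Complex.I) / 2) = 1 / 2 := by
    linear_combination (-1 / 4) * Complex.I_sq
  have h2 : (1 - Complex.I) / 2 * ((1 - Complex.I) / 2) =
      -((1 + Complex.I) / 2 * ((1 + Complex.I) / 2)) := by
    linear_combination (1 / 2) * Complex.I_sq
  rw [mul_comm ((1 + Complex.I) / 2) ((1 - Complex.I) / 2), h1, h2]
  module

lemma HermitianPreserving.exists_eq_conj_map_ofReal (hK : HermitianPreserving K) :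
    ∃ T : Matrix (Fin 2 × Fin 2) (Fin 2 × Fin 2) ℝ,
      K = hermitianFrame * T.map Complex.ofRealHom * hermitianFrameᴴ := by
  have hQ : hermitianFrame * hermitianFrameᴴ = 1 :=
    mem_unitaryGroup_iff.mp hermitianFrame_mem_unitaryGroup
  set M := hermitianFrameᴴ * K * hermitianFrame with hM
  have hreal : M.map (starRingEnd ℂ) = M := by
    rw [hM, Matrix.map_mul, Matrix.map_mul, hermitianPreserving_iff.mp hK, hermitianFrame_map,
      conjTranspose_map (starRingEnd ℂ) fun x => rfl, hermitianFrame_map, conjTranspose_mul,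
      swapMatrix_conjTranspose]
    simp only [Matrix.mul_assoc]
    simp only [← Matrix.mul_assoc swapMatrix swapMatrix, swapMatrix_mul_self, Matrix.one_mul]
  refine ⟨M.map Complex.re, ?_⟩
  have hT : (M.map Complex.re).map Complex.ofRealHom = M := by
    ext p q
    exact Complex.conj_eq_iff_re.mp (congrFun (congrFun hreal p) q)
  rw [hT, hM]
  simp only [Matrix.mul_assoc, hQ, Matrix.mul_one]
  rw [← Matrix.mul_assoc, hQ, Matrix.one_mul]

lemma hermitianPreserving_conj_map_ofReal (T : Matrix (Fin 2 × Fin 2) (Fin 2 × Fin 2) ℝ) :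
    HermitianPreserving (hermitianFrame * T.map Complex.ofRealHom * hermitianFrameᴴ) := by
  have hT : (T.map Complex.ofRealHom).map (starRingEnd ℂ) = T.map Complex.ofRealHom := by
    ext p q
    exact Complex.conj_ofReal _
  rw [hermitianPreserving_iff, Matrix.map_mul, Matrix.map_mul, hT, hermitianFrame_map,
    conjTranspose_map (starRingEnd ℂ) fun x => rfl, hermitianFrame_map, conjTranspose_mul,
    swapMatrix_conjTranspose]
  simp only [Matrix.mul_assoc]

lemma HermitianPreserving.exists_trace_eq_traceNorm (hK : HermitianPreserving K) :
    ∃ W ∈ unitaryGroup (Fin 2 × Fin 2) ℂ, HermitianPreserving W ∧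
      (Wᴴ * K).trace.re = traceNorm K := by
  obtain ⟨T, hT⟩ := hK.exists_eq_conj_map_ofReal
  obtain ⟨O, hO, hOT⟩ := exists_mem_unitaryGroup_trace_eq T
  have hQ : hermitianFrameᴴ * hermitianFrame = 1 :=
    mem_unitaryGroup_iff'.mp hermitianFrame_mem_unitaryGroup
  have hO' : O.map Complex.ofRealHom ∈ unitaryGroup (Fin 2 × Fin 2) ℂ := by
    rw [mem_unitaryGroup_iff', star_eq_conjTranspose, ← map_ofReal_conjTranspose, ← Matrix.map_mul,
      ← star_eq_conjTranspose, mem_unitaryGroup_iff'.mp hO]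
    simp
  refine ⟨_, mul_mem (mul_mem hermitianFrame_mem_unitaryGroup hO')
    (Unitary.star_mem hermitianFrame_mem_unitaryGroup), hermitianPreserving_conj_map_ofReal O, ?_⟩
  rw [traceNorm_eq_sum_of_map_ofReal hermitianFrame_mem_unitaryGroup hT, hT, star_eq_conjTranspose]
  simp only [conjTranspose_mul, conjTranspose_conjTranspose, Matrix.mul_assoc]
  rw [← Matrix.mul_assoc hermitianFrameᴴ hermitianFrame, hQ, Matrix.one_mul, trace_mul_comm]
  simp only [Matrix.mul_assoc, hQ, Matrix.mul_one]
  rw [← map_ofReal_conjTranspose, ← Matrix.map_mul, ← AddMonoidHom.map_trace, hOT]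
  simp

end HermitianFrame

lemma traceNorm_realign_le_one_of_two_two {ρ : Matrix (Fin 2 × Fin 2) (Fin 2 × Fin 2) ℂ}
    (hρ : ρ.PosSemidef) (htr : ρ.trace = 1) (hppt : AbsolutelyPPT ρ) :
    traceNorm (realign ρ) ≤ 1 := by
  have hR : HermitianPreserving (realign ρ) := fun i j k l => (hρ.1.apply _ _).symm
  obtain ⟨W, hW, hH, hWR⟩ := hR.exists_trace_eq_traceNorm
  simpa [hWR, htr] using realignmentBound_of_hermitianPreserving hW hH ρ hρ hppt

/-- The realignment criterion cannot detect entanglement in any absolutely PPT state: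
if `ρ` is absolutely PPT then `‖R(ρ)‖_tr ≤ 1`. -/
theorem realignment_of_absPPT {m n : ℕ} (hm : 1 ≤ m) (hn : 1 ≤ n)
    (ρ : Matrix (Fin m × Fin n) (Fin m × Fin n) ℂ)
    (hρ : ρ.PosSemidef) (htr : ρ.trace = 1) (hppt : AbsolutelyPPT ρ) :
    traceNorm (realign ρ) ≤ 1 := by
  by_cases h1 : min m n = 1
  · exact traceNorm_realign_le_one_of_min_eq_one h1 ρ hρ htr
  by_cases h2 : m = 2 ∧ n = 2
  · obtain ⟨rfl, rfl⟩ := h2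
    exact traceNorm_realign_le_one_of_two_two hρ htr hppt
  have hm2 : 2 ≤ m := by omega
  have hn2 : 2 ≤ n := by omega
  refine traceNorm_realign_le_one_of_six_le hm2 hn2 ?_ ρ hρ htr hppt
  have : 3 ≤ m ∨ 3 ≤ n := by omega
  rcases this with h | h <;> nlinarith

end
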